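/- Let H₁ and H₂ be complex Hilbert spaces and let T : H₁ →. H₂ be a densely defined closed linear operator with adjoint T†. If T has closed range, then there exists a constant C > 0 such that for every α ∈ H₂ orthogonal to ker T† there exists φ ∈ H₂ with: φ ∈ dom T†, T†φ ∈ dom T, T(T†φ) = α, φ orthogonal to ker T†, and ‖φ‖ ≤ C‖α‖. -/

import Mathlib

open scoped InnerProductSpace

/-- A closed operator with closed range has a bounded right inverse on its range taking values in
the orthogonal complement of its kernel. -/
theorem LinearPMap.exists_rightInverse_of_isClosed_range {𝕜 E F : Type*} [RCLike 𝕜]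
    [NormedAddCommGroup E] [InnerProductSpace 𝕜 E] [CompleteSpace E]
    [NormedAddCommGroup F] [NormedSpace 𝕜 F] [CompleteSpace F]
    (T : E →ₗ.[𝕜] F) (hclosed : T.IsClosed)
    (hrange : _root_.IsClosed (T.toFun.range : Set F)) :
    ∃ S : T.toFun.range →L[𝕜] E, ∀ r, (S r, (r : F)) ∈ T.graph ∧
      ∀ k, (k, (0 : F)) ∈ T.graph → inner 𝕜 (S r) k = 0 := by
  let K : Submodule 𝕜 E := T.graph.comap (LinearMap.inl 𝕜 E F)
  have hK : _root_.IsClosed (K : Set E) :=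
    hclosed.preimage (f := fun x : E => (x, (0 : F))) (by fun_prop)
  have : CompleteSpace K := hK.completeSpace_coe
  let G : Submodule 𝕜 (E × F) := T.graph ⊓ Kᗮ.comap (LinearMap.fst 𝕜 E F)
  have hG : _root_.IsClosed (G : Set (E × F)) :=
    _root_.IsClosed.inter hclosed (K.isClosed_orthogonal.preimage continuous_fst)
  have : CompleteSpace G := hG.completeSpace_coe
  have : CompleteSpace T.toFun.range := hrange.completeSpace_coe
  have hmem : ∀ p ∈ T.graph, p.2 ∈ T.toFun.range := by
    intro p hp
    obtain ⟨y, -, hy⟩ := T.mem_graph_iff.1 hp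
    exact ⟨y, hy⟩
  let P : G →L[𝕜] T.toFun.range :=
    ((ContinuousLinearMap.snd 𝕜 E F).comp G.subtypeL).codRestrict _ fun p => hmem _ p.2.1
  have hinj : P.ker = ⊥ := by
    refine LinearMap.ker_eq_bot'.2 fun p hp => ?_
    obtain ⟨⟨x, y⟩, hgraph, hperp⟩ := p
    obtain rfl : y = 0 := congrArg Subtype.val hp
    have hx : x = 0 := inner_self_eq_zero.1 (hperp x hgraph)
    exact Subtype.ext (Prod.ext hx rfl)
  have hsurj : P.range = ⊤ := by
    refine LinearMap.range_eq_top.2 ?_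
    rintro ⟨_, y, rfl⟩
    have hk : ((K.starProjection (y : E) : E), (0 : F)) ∈ T.graph :=
      K.starProjection_apply_mem (y : E)
    have hsub := T.graph.sub_mem (T.mem_graph y) hk
    refine ⟨⟨_, hsub, K.sub_starProjection_mem_orthogonal (y : E)⟩, Subtype.ext ?_⟩
    exact sub_zero _
  let e := ContinuousLinearEquiv.ofBijective P hinj hsurj
  refine ⟨((ContinuousLinearMap.fst 𝕜 E F).comp G.subtypeL).comp
    (e.symm : T.toFun.range →L[𝕜] G), fun r => ⟨?_, fun k hk => ?_⟩⟩
  · have hr : ((e.symm r : G) : E × F).2 = r := congrArg Subtype.val (e.apply_symm_apply r)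
    rw [← hr]
    exact (e.symm r).2.1
  · exact (Submodule.mem_orthogonal' _ _).1 (e.symm r).2.2 k hk

/-- If a densely defined closed linear operator `T` between complex Hilbert spaces has closed
range, then there is a constant `C > 0` such that for every `α ∈ H₂` orthogonal to `ker T†`
there exists `φ ∈ dom T†` with `T†φ ∈ dom T`, `T(T†φ) = α`, `φ ⊥ ker T†`, and `‖φ‖ ≤ C‖α‖`. -/
theorem exists_bounded_laplacian_solution_of_closed_range
    {H₁ H₂ : Type*}
    [NormedAddCommGroup H₁] [InnerProductSpace ℂ H₁] [CompleteSpace H₁]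
    [NormedAddCommGroup H₂] [InnerProductSpace ℂ H₂] [CompleteSpace H₂]
    (T : H₁ →ₗ.[ℂ] H₂)
    (hdense : Dense (T.domain : Set H₁))
    (hclosed : T.IsClosed)
    (hrange : IsClosed (Set.range fun x : T.domain => T x)) :
    ∃ C : ℝ, 0 < C ∧
      ∀ α : H₂,
        (∀ ψ : T.adjoint.domain, T.adjoint ψ = 0 → ⟪α, (ψ : H₂)⟫_ℂ = 0) →
        ∃ (φ : T.adjoint.domain) (h : T.adjoint φ ∈ T.domain),
          T ⟨T.adjoint φ, h⟩ = α ∧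
          (∀ ψ : T.adjoint.domain, T.adjoint ψ = 0 → ⟪(φ : H₂), (ψ : H₂)⟫_ℂ = 0) ∧
          ‖(φ : H₂)‖ ≤ C * ‖α‖ := by
  let R : Submodule ℂ H₂ := T.toFun.range
  have hR : IsClosed (R : Set H₂) := hrange
  have : CompleteSpace R := hR.completeSpace_coe
  obtain ⟨S, hS⟩ := T.exists_rightInverse_of_isClosed_range hclosed hR
  have hker : ∀ ψ : T.adjoint.domain, T.adjoint ψ = 0 → (ψ : H₂) ∈ Rᗮ := by
    rintro ψ hψ _ ⟨y, rfl⟩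
    have h := T.adjoint_isFormalAdjoint hdense ψ y
    rw [hψ, inner_zero_left] at h
    exact inner_eq_zero_symm.1 h.symm
  refine ⟨‖S‖ * ‖S‖ + 1, by positivity, fun α hα => ?_⟩
  have hαR : α ∈ R := by
    rw [← R.orthogonal_orthogonal, Submodule.mem_orthogonal']
    intro ψ hψ
    have hzero : ∀ x : T.domain, ⟪(0 : H₁), x⟫_ℂ = ⟪ψ, T x⟫_ℂ := fun x => by
      rw [inner_zero_left]
      exact ((Submodule.mem_orthogonal' _ _).1 hψ _ ⟨x, rfl⟩).symm
    exact hα ⟨ψ, T.mem_adjoint_domain_of_exists ψ ⟨0, hzero⟩⟩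
      (LinearPMap.adjoint_apply_eq hdense _ hzero)
  let a : R := ⟨α, hαR⟩
  let φ : R := S.adjoint (S a)
  have hφ : ∀ y : T.domain, ⟪S a, (y : H₁)⟫_ℂ = ⟪(φ : H₂), T y⟫_ℂ := by
    intro y
    let b : R := ⟨T y, y, rfl⟩
    have hdiff : ((y : H₁) - S b, (0 : H₂)) ∈ T.graph := by
      simpa [b] using T.graph.sub_mem (T.mem_graph y) (hS b).1
    have horth := (hS a).2 _ hdiff
    rw [inner_sub_right, sub_eq_zero] at horth
    exact horth.trans (S.adjoint_inner_left b (S a)).symm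
  have hφdom := T.mem_adjoint_domain_of_exists (φ : H₂) ⟨S a, hφ⟩
  have hadj : T.adjoint ⟨φ, hφdom⟩ = S a := LinearPMap.adjoint_apply_eq hdense _ hφ
  obtain ⟨y, hy, hTy⟩ := T.mem_graph_iff.1 (hS a).1
  have hdom : T.adjoint ⟨φ, hφdom⟩ = (y : H₁) := hadj.trans hy.symm
  refine ⟨⟨φ, hφdom⟩, hdom ▸ y.2, ?_, fun ψ hψ => hker ψ hψ φ φ.2, ?_⟩
  · exact (congrArg T (Subtype.ext hdom)).trans hTy
  · calc ‖(φ : H₂)‖ ≤ ‖S.adjoint‖ * ‖S a‖ := S.adjoint.le_opNorm _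
      _ ≤ ‖S‖ * (‖S‖ * ‖α‖) := by
        rw [LinearIsometryEquiv.norm_map]
        gcongr
        exact S.le_opNorm a
      _ ≤ (‖S‖ * ‖S‖ + 1) * ‖α‖ := by nlinarith [norm_nonneg α]
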